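/- Suppose a real number x is a Trott number in base b and also a Trott number in base c, where 2 ≤ b < c are integers. Then there exists an integer k ≥ 1 with k²+1 ≤ b < c ≤ k²+k (in particular ⌊√b⌋ = ⌊√c⌋). Moreover, if a_2 denotes the second partial quotient of the continued fraction expansion of x, and a_2 has l digits in base b and m digits in base c, then 2 ≤ m < l. -/

import Mathlib

open Filter Topology

/-- Number of digits of `a` in base `b`. -/
def digLen (b a : ℕ) : ℕ := (Nat.digits b a).length

/-- Value of the finite continued fraction `[0; a₁, a₂, …, aₙ]`. -/
noncomputable def cfVal : List ℕ → ℝ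
  | [] => 0
  | (h :: t) => 1 / ((h : ℝ) + cfVal t)

/-- `a` witnesses that `x` is a Trott number in base `b`: the `a i` (indexed from 0)
are positive, `x` is the value of the infinite continued fraction `[0; a 0, a 1, …]`,
and the base-`b` expansion of `x` is the concatenation of the base-`b` digit strings
of the partial quotients. -/
def IsTrottWith (b : ℕ) (x : ℝ) (a : ℕ → ℕ) : Prop :=
  (∀ i, 0 < a i) ∧
  Tendsto (fun n => cfVal ((List.range n).map a)) atTop (𝓝 x) ∧
  x = ∑' i : ℕ, (a i : ℝ) / (b : ℝ) ^ (∑ j ∈ Finset.range (i + 1), digLen b (a j))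

/-- `x` is a Trott number in base `b`. -/
def IsTrott (b : ℕ) (x : ℝ) : Prop := ∃ a, IsTrottWith b x a

/-- The set of Trott numbers in base `b`. -/
def TrottSet (b : ℕ) : Set ℝ := {x | IsTrott b x}

theorem lt_pow_digLen {b : ℕ} (hb : 2 ≤ b) (a : ℕ) : a < b ^ digLen b a :=
  Nat.lt_base_pow_length_digits hb

theorem digLen_pos {b a : ℕ} (hb : 2 ≤ b) (ha : 0 < a) : 0 < digLen b a := by
  rcases Nat.eq_zero_or_pos (digLen b a) with h0 | h0
  · have := lt_pow_digLen hb a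
    rw [h0] at this
    simp at this
    omega
  · exact h0

theorem pow_pred_digLen_le {b a : ℕ} (hb : 2 ≤ b) (ha : 0 < a) : b ^ (digLen b a - 1) ≤ a := by
  have h : b ^ digLen b a ≤ b * a := Nat.base_pow_length_digits_le b a hb ha.ne'
  have hpos := (digLen_pos hb ha).ne'
  obtain ⟨n, hn⟩ := Nat.exists_eq_succ_of_ne_zero hpos
  rw [hn, Nat.pow_succ'] at h
  rw [hn]
  exact Nat.le_of_mul_le_mul_left h (by omega)

/-- The real number whose base-`b` expansion is the concatenation of the digit strings of `a`. -/
noncomputable def concatVal (b : ℕ) (a : ℕ → ℕ) : ℝ :=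
  ∑' i : ℕ, (a i : ℝ) / (b : ℝ) ^ (∑ j ∈ Finset.range (i + 1), digLen b (a j))

theorem sum_concat_le {b : ℕ} (hb : 2 ≤ b) (a : ℕ → ℕ) (n : ℕ) :
    ∑ i ∈ Finset.range n, (a i : ℝ) / (b : ℝ) ^ (∑ j ∈ Finset.range (i + 1), digLen b (a j)) ≤
      1 - 1 / (b : ℝ) ^ (∑ j ∈ Finset.range n, digLen b (a j)) := by
  induction n with
  | zero => simp
  | succ n ih =>
    rw [Finset.sum_range_succ]
    refine (add_le_add_left ih _).trans ?_
    rw [Finset.sum_range_succ, pow_add]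
    have hb0 : (0 : ℝ) < b := by positivity
    have h : (a n : ℝ) + 1 ≤ (b : ℝ) ^ digLen b (a n) := by exact_mod_cast lt_pow_digLen hb (a n)
    have hB : (0 : ℝ) < (b : ℝ) ^ digLen b (a n) := by positivity
    have hA : (0 : ℝ) < (b : ℝ) ^ (∑ j ∈ Finset.range n, digLen b (a j)) := by positivity
    generalize (b : ℝ) ^ digLen b (a n) = B at *
    generalize (b : ℝ) ^ (∑ j ∈ Finset.range n, digLen b (a j)) = A at *
    have h1 : 1 / A - 1 / (A * B) - a n / (A * B) = (B - 1 - a n) / (A * B) := by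
      field_simp
    have h2 : 0 ≤ (B - 1 - a n) / (A * B) := div_nonneg (by linarith) (by positivity)
    linarith

theorem sum_concat_le_one {b : ℕ} (hb : 2 ≤ b) (a : ℕ → ℕ) (n : ℕ) :
    ∑ i ∈ Finset.range n, (a i : ℝ) / (b : ℝ) ^ (∑ j ∈ Finset.range (i + 1), digLen b (a j)) ≤ 1 :=
  (sum_concat_le hb a n).trans (sub_le_self _ (by positivity))

theorem summable_concat {b : ℕ} (hb : 2 ≤ b) (a : ℕ → ℕ) :
    Summable fun i => (a i : ℝ) / (b : ℝ) ^ (∑ j ∈ Finset.range (i + 1), digLen b (a j)) :=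
  summable_of_sum_range_le (fun _ => by positivity) (sum_concat_le_one hb a)

theorem concatVal_nonneg (b : ℕ) (a : ℕ → ℕ) : 0 ≤ concatVal b a :=
  tsum_nonneg fun _ => by positivity

theorem concatVal_le_one {b : ℕ} (hb : 2 ≤ b) (a : ℕ → ℕ) : concatVal b a ≤ 1 :=
  Real.tsum_le_of_sum_range_le (fun _ => by positivity) (sum_concat_le_one hb a)

theorem pow_digLen_mul_concatVal {b : ℕ} (hb : 2 ≤ b) (a : ℕ → ℕ) :
    (b : ℝ) ^ digLen b (a 0) * concatVal b a = a 0 + concatVal b fun i => a (i + 1) := by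
  have hb0 : (b : ℝ) ≠ 0 := by positivity
  unfold concatVal
  rw [(summable_concat hb a).tsum_eq_zero_add, mul_add, ← tsum_mul_left]
  congr 1
  · simp
    field_simp
  · refine tsum_congr fun i => ?_
    rw [Finset.sum_range_succ' _ (i + 1), pow_add]
    field_simp

/-- A Trott number lies in the interior of its cylinder of order two. -/
theorem exists_complete_quotient {x : ℝ} {a : ℕ → ℕ} (ha : ∀ i, 0 < a i)
    (hx : Tendsto (fun n => cfVal ((List.range n).map a)) atTop (𝓝 x)) :
    ∃ z : ℝ, (a 1 : ℝ) < z ∧ z < a 1 + 1 ∧ x * (a 0 * z + 1) = z := by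
  have hr (i : ℕ) : (1 : ℝ) ≤ a i := by exact_mod_cast ha i
  have cf_nonneg (l : List ℕ) : 0 ≤ cfVal l := by
    induction l with
    | nil => simp [cfVal]
    | cons h t ih => unfold cfVal; positivity
  have cf_le_one (i : ℕ) (l : List ℕ) : cfVal (a i :: l) ≤ 1 := by
    have h1 := hr i
    have h2 := cf_nonneg l
    rw [cfVal, div_le_one (by linarith)]
    linarith
  set K := Set.Icc (1 / ((a 2 : ℝ) + 1)) (1 / ((a 2 : ℝ) + 1 / (a 3 + 1)))
  have hpos : 0 < 1 / ((a 2 : ℝ) + 1) := by positivity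
  have hcont : ContinuousOn (fun t : ℝ => 1 / ((a 0 : ℝ) + 1 / (a 1 + t))) K := by
    have h0 := hr 0
    have h1 := hr 1
    refine ContinuousOn.div continuousOn_const (ContinuousOn.add continuousOn_const
      (ContinuousOn.div continuousOn_const (by fun_prop) ?_)) ?_
    · intro t ht
      have : 0 < t := hpos.trans_le ht.1
      positivity
    · intro t ht
      have : 0 < t := hpos.trans_le ht.1
      positivity
  have hmem : x ∈ (fun t : ℝ => 1 / ((a 0 : ℝ) + 1 / (a 1 + t))) '' K := by
    refine (isCompact_Icc.image_of_continuousOn hcont).isClosed.mem_of_tendsto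
      ((tendsto_add_atTop_iff_nat 5).2 hx) (Eventually.of_forall fun n => ?_)
    obtain ⟨l, hl⟩ : ∃ l, (List.range (n + 5)).map a = a 0 :: a 1 :: a 2 :: a 3 :: a 4 :: l := by
      refine ⟨(List.range n).map fun i => a (i + 5), ?_⟩
      simp [List.range_succ_eq_map, Function.comp_def]
    refine ⟨cfVal (a 2 :: a 3 :: a 4 :: l), ?_, ?_⟩
    · have h2 := hr 2
      have h3 := hr 3
      have hn := cf_nonneg (a 4 :: l)
      rw [cfVal]
      refine ⟨one_div_le_one_div_of_le (by have := cf_nonneg (a 3 :: a 4 :: l); linarith)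
        (by have := cf_le_one 3 (a 4 :: l); linarith), one_div_le_one_div_of_le (by positivity) ?_⟩
      rw [cfVal]
      have := one_div_le_one_div_of_le (a := (a 3 : ℝ) + cfVal (a 4 :: l)) (b := a 3 + 1)
        (by linarith) (by have := cf_le_one 4 l; linarith)
      linarith
    · simp only [hl, cfVal]
  obtain ⟨t, ht, rfl⟩ := hmem
  have ht0 : 0 < t := hpos.trans_le ht.1
  have ht1 : t < 1 := by
    refine ht.2.trans_lt ?_
    have h2 := hr 2
    have h3 : 0 < 1 / ((a 3 : ℝ) + 1) := by positivity
    rw [div_lt_one (by positivity)]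
    linarith
  refine ⟨a 1 + t, by linarith, by linarith, ?_⟩
  have h0 := hr 0
  have h1 := hr 1
  field_simp

/-- In any base, the first partial quotient of a Trott number is a single digit, and it is the
integer part of the square root of the (nonsquare) base. -/
theorem digLen_eq_one_of_bounds {b p : ℕ} {x y z : ℝ} (hb : 2 ≤ b) (hp : 0 < p) (hz : 1 < z)
    (hx : x * (p * z + 1) = z) (hxy : (b : ℝ) ^ digLen b p * x = p + y) (hy0 : 0 ≤ y)
    (hy1 : y ≤ 1) : digLen b p = 1 ∧ p ^ 2 < b ∧ b < (p + 1) ^ 2 := by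
  have hp' : (1 : ℝ) ≤ p := by exact_mod_cast hp
  have hD : (0 : ℝ) < p * z + 1 := by positivity
  have key : (b : ℝ) ^ digLen b p * z = (p + y) * (p * z + 1) := by
    rw [← hxy, mul_assoc, hx]
  have h1 : p ^ 2 < b ^ digLen b p := by
    suffices (p : ℝ) ^ 2 < (b : ℝ) ^ digLen b p by exact_mod_cast this
    refine lt_of_mul_lt_mul_right ?_ (by linarith : 0 ≤ z)
    rw [key]
    nlinarith [mul_nonneg hy0 hD.le]
  have h2 : b ^ digLen b p < (p + 1) ^ 2 := by
    suffices (b : ℝ) ^ digLen b p < ((p : ℝ) + 1) ^ 2 by exact_mod_cast this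
    refine lt_of_mul_lt_mul_right ?_ (by linarith : 0 ≤ z)
    rw [key]
    nlinarith [mul_nonneg (sub_nonneg.2 hy1) hD.le]
  have hlen : digLen b p = 1 := by
    have hpos := digLen_pos hb hp
    have h3 := Nat.pow_le_pow_left (pow_pred_digLen_le hb hp) 2
    rw [← pow_mul] at h3
    have := (Nat.pow_lt_pow_iff_right hb).1 (h3.trans_lt h1)
    omega
  rw [hlen, pow_one] at h1 h2
  exact ⟨hlen, h1, h2⟩

/-- The digits of a Trott number after the first partial quotient. -/
theorem IsTrottWith.exists_tail {b : ℕ} {x : ℝ} {a : ℕ → ℕ} (hb : 2 ≤ b)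
    (h : IsTrottWith b x a) {z : ℝ} (hz1 : 1 < z) (hz : x * (a 0 * z + 1) = z) :
    a 0 ^ 2 < b ∧ b < (a 0 + 1) ^ 2 ∧ ∃ y : ℝ, 0 ≤ y ∧ y ≤ 1 ∧
      y * (a 0 * z + 1) = ((b : ℝ) - a 0 ^ 2) * z - a 0 ∧
      (a 1 : ℝ) ≤ (b : ℝ) ^ digLen b (a 1) * y ∧ (b : ℝ) ^ digLen b (a 1) * y ≤ a 1 + 1 := by
  obtain ⟨ha, -, hs⟩ := h
  have hx : x = concatVal b a := hs
  have e0 := pow_digLen_mul_concatVal hb a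
  have e1 := pow_digLen_mul_concatVal hb fun i => a (i + 1)
  have hy0 := concatVal_nonneg b fun i => a (i + 1)
  have hy1 := concatVal_le_one hb fun i => a (i + 1)
  have hw0 := concatVal_nonneg b fun i => a (i + 1 + 1)
  have hw1 := concatVal_le_one hb fun i => a (i + 1 + 1)
  simp only [zero_add] at e1
  rw [← hx] at e0
  obtain ⟨hlen, h1, h2⟩ := digLen_eq_one_of_bounds hb (ha 0) hz1 hz e0 hy0 hy1
  rw [hlen, pow_one] at e0
  refine ⟨h1, h2, _, hy0, hy1, ?_, by linarith, by linarith⟩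
  linear_combination (b : ℝ) * hz - (a 0 * z + 1) * e0

/-- If the second partial quotient had equally many digits in both bases, the tails would be too
far apart to share it. -/
theorem lt_pow_mul_sub_pow_mul {p b c l : ℕ} {z y w : ℝ} (hp : 0 < p) (hpb : p ^ 2 < b)
    (hbc : b < c) (hl : 0 < l) (hz : 1 < z) (hw0 : 0 ≤ w)
    (hy : y * (p * z + 1) = ((b : ℝ) - p ^ 2) * z - p)
    (hw : w * (p * z + 1) = ((c : ℝ) - p ^ 2) * z - p) :
    1 < (c : ℝ) ^ l * w - (b : ℝ) ^ l * y := by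
  have hp' : (1 : ℝ) ≤ p := by exact_mod_cast hp
  have hpb' : (p : ℝ) ^ 2 + 1 ≤ b := by exact_mod_cast hpb
  have hbc' : (b : ℝ) + 1 ≤ c := by exact_mod_cast hbc
  have hD : (0 : ℝ) < p * z + 1 := by positivity
  have h1 : 1 < (c : ℝ) * w - b * y := by
    refine lt_of_mul_lt_mul_right ?_ hD.le
    have e : ((c : ℝ) * w - b * y) * (p * z + 1) =
        ((c : ℝ) - b) * ((c + b - p ^ 2) * z - p) := by
      linear_combination (c : ℝ) * hw - b * hy
    rw [e]
    have h2 : (p : ℝ) * z + 1 < (c + b - p ^ 2) * z - p := by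
      nlinarith [sq_nonneg ((p : ℝ) - 1)]
    nlinarith
  obtain ⟨n, rfl⟩ := Nat.exists_eq_succ_of_ne_zero hl.ne'
  have hbn : (1 : ℝ) ≤ (b : ℝ) ^ n := one_le_pow₀ (by nlinarith)
  have hcn : (b : ℝ) ^ n ≤ (c : ℝ) ^ n := pow_le_pow_left₀ (by positivity) (by linarith) n
  have hcw : 0 ≤ (c : ℝ) * w := by positivity
  rw [Nat.succ_eq_add_one, pow_succ, pow_succ]
  nlinarith [mul_le_mul_of_nonneg_right hcn hcw]

theorem digLen_le_digLen {b c a : ℕ} (hb : 2 ≤ b) (hbc : b ≤ c) (ha : 0 < a) :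
    digLen c a ≤ digLen b a := by
  have h1 := Nat.pow_le_pow_left hbc (digLen c a - 1)
  have h2 := (h1.trans (pow_pred_digLen_le (hb.trans hbc) ha)).trans_lt (lt_pow_digLen hb a)
  have := (Nat.pow_lt_pow_iff_right hb).1 h2
  omega

theorem digLen_eq_one {b a : ℕ} (hb : 2 ≤ b) (ha : 0 < a) (hab : a < b) : digLen b a = 1 := by
  have h1 := (pow_pred_digLen_le hb ha).trans_lt (hab.trans_eq (pow_one b).symm)
  have := (Nat.pow_lt_pow_iff_right hb).1 h1
  have := digLen_pos hb ha
  omega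

/-- The second partial quotient cannot be at least `b` and a single digit in base `c`. -/
theorem not_single_digit {p q b c : ℕ} {z y w : ℝ} (hpb : p ^ 2 < b) (hbc : b < c)
    (hc : c ≤ p ^ 2 + p) (hbq : b ≤ q) (hqc : q < c) (hqz : (q : ℝ) < z) (hzq : z < q + 1)
    (hy : y * (p * z + 1) = ((b : ℝ) - p ^ 2) * z - p)
    (hw : w * (p * z + 1) = ((c : ℝ) - p ^ 2) * z - p)
    (hyq : (b : ℝ) ^ 2 * y ≤ q + 1) (hwq : (q : ℝ) ≤ c * w) : False := by
  have hp2 : 2 ≤ p := by nlinarith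
  obtain ⟨d, hd⟩ := Nat.exists_eq_add_of_lt hpb
  have hpR : (2 : ℝ) ≤ p := by exact_mod_cast hp2
  have hbR : (p : ℝ) ^ 2 + 1 ≤ b := by exact_mod_cast hpb
  have hbqR : (b : ℝ) ≤ q := by exact_mod_cast hbq
  have hq2 : (q : ℝ) + 1 ≤ b * 2 := by
    have : q + 1 ≤ b * 2 := by nlinarith
    exact_mod_cast this
  have hb0 : (0 : ℝ) < b := by nlinarith
  have hz0 : 0 < z := by linarith
  have hD : (0 : ℝ) < p * z + 1 := by positivity
  have hby : b * y ≤ 2 := le_of_mul_le_mul_left (by nlinarith) hb0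
  have hdR : (b : ℝ) - p ^ 2 = (d + 1 : ℕ) := by
    rw [hd]
    push_cast
    ring
  have hsmall : b * (d + 1) ≤ 3 * p := by
    by_contra! hcon
    have hcon' : 3 * (p : ℝ) + 1 ≤ b * (d + 1 : ℕ) := by exact_mod_cast hcon
    have h1 : b * ((d + 1 : ℕ) * z - p) ≤ 2 * (p * z + 1) := by
      rw [← hdR, ← hy, ← mul_assoc]
      exact mul_le_mul_of_nonneg_right hby hD.le
    have h2 := mul_le_mul_of_nonneg_right hcon' hz0.le
    nlinarith
  have hpe : p = 2 := by nlinarith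
  subst hpe
  obtain rfl : b = 5 := by nlinarith
  obtain rfl : c = 6 := by omega
  obtain rfl : q = 5 := by omega
  push_cast at *
  nlinarith

/-- If `x` is a Trott number in two bases `2 ≤ b < c` (with common continued fraction
expansion `a`, which is unique since `x` is irrational), then `b` and `c` lie in a common
interval `[k²+1, k²+k]` (in particular `⌊√b⌋ = ⌊√c⌋`), and the second partial quotient
`a 1` has `m` digits in base `c` and `l` digits in base `b` with `2 ≤ m < l`. -/
theorem trott_two_bases_digits (b c : ℕ) (hb : 2 ≤ b) (hbc : b < c)
    (x : ℝ) (a : ℕ → ℕ) (hxb : IsTrottWith b x a) (hxc : IsTrottWith c x a) :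
    (∃ k : ℕ, 1 ≤ k ∧ k ^ 2 + 1 ≤ b ∧ c ≤ k ^ 2 + k) ∧
    Nat.sqrt b = Nat.sqrt c ∧
    2 ≤ digLen c (a 1) ∧ digLen c (a 1) < digLen b (a 1) := by
  obtain ⟨z, hqz, hzq, hz⟩ := exists_complete_quotient hxb.1 hxb.2.1
  have hc : 2 ≤ c := hb.trans hbc.le
  have hp := hxb.1 0
  have hq := hxb.1 1
  have hq' : (1 : ℝ) ≤ a 1 := by exact_mod_cast hq
  have hz1 : 1 < z := by linarith
  obtain ⟨hb1, hb2, y, hy0, hy1, hy, hyl, hyu⟩ := hxb.exists_tail hb hz1 hz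
  obtain ⟨hc1, hc2, w, hw0, hw1, hw, hwl, hwu⟩ := hxc.exists_tail hc hz1 hz
  have hlt : digLen c (a 1) < digLen b (a 1) := by
    refine lt_of_le_of_ne (digLen_le_digLen hb hbc.le hq) fun heq => ?_
    have := lt_pow_mul_sub_pow_mul hp hb1 hbc (digLen_pos hb hq) hz1 hw0 hy hw
    rw [heq] at hwu
    linarith
  have hcp : c ≤ a 0 ^ 2 + a 0 := by
    by_contra! hcon
    have hcon' : (a 0 : ℝ) ^ 2 + a 0 + 1 ≤ c := by exact_mod_cast hcon
    have hqp : a 1 < a 0 + 1 := by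
      suffices (a 1 : ℝ) < a 0 + 1 by exact_mod_cast this
      have hD : (0 : ℝ) < a 0 * z + 1 := by positivity
      nlinarith
    have hlb : digLen b (a 1) = 1 := digLen_eq_one hb hq (by nlinarith)
    have := digLen_pos hc hq
    omega
  refine ⟨⟨a 0, hp, hb1, hcp⟩, ?_, ?_, hlt⟩
  · rw [Nat.eq_sqrt'.2 ⟨hb1.le, hb2⟩ |>.symm, Nat.eq_sqrt'.2 ⟨hc1.le, hc2⟩ |>.symm]
  · by_contra! hm
    have hm1 : digLen c (a 1) = 1 := by have := digLen_pos hc hq; omega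
    have hqc : a 1 < c := by simpa [hm1] using lt_pow_digLen hc (a 1)
    have hbq : b ≤ a 1 := by
      by_contra! h
      have := digLen_eq_one hb hq h
      omega
    rw [hm1, pow_one] at hwl
    refine not_single_digit hb1 hbc hcp hbq hqc hqz hzq hy hw (le_trans ?_ hyu) hwl
    exact mul_le_mul_of_nonneg_right
      (pow_le_pow_right₀ (by exact_mod_cast (by omega : 1 ≤ b)) (by omega)) hy0
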